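/- Let X, X_1, …, X_n be i.i.d. from a distribution F on ℝ^p, let g, ĝ : ℝ^p → ℝ be measurable with sup_x |ĝ(x) − g(x)| ≤ R, let G be the CDF of g(X) and Ĝ(t) = (1/n) Σ_{i=1}^n 1_{g(X_i) ≤ t} its empirical CDF. Then for every threshold c ∈ ℝ, | (1/n) Σ_{i=1}^n 1_{ĝ(X_i) ≤ c} − P_F( ĝ(X) ≤ c ) | ≤ sup_t |Ĝ(t) − G(t)| + ( G(c + R) − G(c − R) ). -/

import Mathlib

open MeasureTheory
open scoped Classical

/-- if `sup_x |ĝ(x) − g(x)| ≤ R`, then for every threshold `c` the empirical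
frequency of `{ĝ(X_i) ≤ c}` over `n` i.i.d. samples from `F` differs from the population
probability `P_F(ĝ(X) ≤ c)` by at most the Kolmogorov distance `sup_t |Ĝ(t) − G(t)|`
between the empirical and true CDFs of `g(X)` plus the `G`-mass `G(c+R) − G(c−R)` of the
band `(c − R, c + R]`. -/
theorem empirical_frequency_band_bound (p n : ℕ)
    (F : Measure (Fin p → ℝ)) [IsProbabilityMeasure F]
    (g ghat : (Fin p → ℝ) → ℝ) (hgmeas : Measurable g) (hghatmeas : Measurable ghat)
    (R : ℝ) (hR : ∀ x, |ghat x - g x| ≤ R)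
    (Ω : Type*) [MeasurableSpace Ω] (P : Measure Ω) [IsProbabilityMeasure P]
    (X : Fin n → Ω → (Fin p → ℝ)) (hXmeas : ∀ i, Measurable (X i))
    (hiid : Measure.map (fun ω => fun i : Fin n => X i ω) P
      = Measure.pi fun _ : Fin n => F)
    (G : ℝ → ℝ) (hG : ∀ t, G t = (F {x | g x ≤ t}).toReal)
    (Ghat : Ω → ℝ → ℝ)
    (hGhat : ∀ ω t, Ghat ω t
      = (1 / (n : ℝ)) * ∑ i : Fin n, if g (X i ω) ≤ t then (1 : ℝ) else 0) :
    ∀ ω, ∀ c : ℝ,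
      |(1 / (n : ℝ)) * (∑ i : Fin n, if ghat (X i ω) ≤ c then (1 : ℝ) else 0)
          - (F {x | ghat x ≤ c}).toReal|
        ≤ (⨆ t : ℝ, |Ghat ω t - G t|) + (G (c + R) - G (c - R)) := by
  intro ω c
  have hn : (0 : ℝ) ≤ 1 / (n : ℝ) := by positivity
  have hmono : ∀ (a b : Fin n → Prop) [DecidablePred a] [DecidablePred b], (∀ i, a i → b i) →
      (1 / (n : ℝ)) * (∑ i : Fin n, if a i then (1 : ℝ) else 0)
        ≤ (1 / (n : ℝ)) * (∑ i : Fin n, if b i then (1 : ℝ) else 0) := by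
    intro a b _ _ hab
    refine mul_le_mul_of_nonneg_left (Finset.sum_le_sum fun i _ => ?_) hn
    by_cases ha : a i
    · simp [ha, hab i ha]
    · rw [if_neg ha]
      split_ifs <;> norm_num
  have hF : ∀ s t : Set (Fin p → ℝ), s ⊆ t → (F s).toReal ≤ (F t).toReal := fun s t h =>
    ENNReal.toReal_mono (measure_ne_top F t) (measure_mono h)
  have hbdd : BddAbove (Set.range fun t : ℝ => |Ghat ω t - G t|) := by
    refine ⟨(1 / (n : ℝ)) * (∑ i : Fin n, (1 : ℝ))
      + (F Set.univ).toReal, ?_⟩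
    rintro _ ⟨t, rfl⟩
    have h1 := hmono (fun i => g (X i ω) ≤ t) (fun _ => True) (fun _ _ => trivial)
    have h2 := hmono (fun _ => False) (fun i => g (X i ω) ≤ t) (fun _ h => h.elim)
    have h3 := hF _ _ (Set.subset_univ {x | g x ≤ t})
    have h4 : 0 ≤ (F {x | g x ≤ t}).toReal := ENNReal.toReal_nonneg
    simp only [if_true] at h1
    simp only [if_false, Finset.sum_const_zero, mul_zero] at h2
    show |Ghat ω t - G t| ≤ _
    rw [hGhat, hG, abs_le]
    constructor <;> linarith
  have hs : ∀ t, |Ghat ω t - G t| ≤ ⨆ t : ℝ, |Ghat ω t - G t| := fun t => le_ciSup hbdd t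
  have hup := abs_le.1 (hs (c + R))
  have hlo := abs_le.1 (hs (c - R))
  have a1 := hmono (fun i => ghat (X i ω) ≤ c) (fun i => g (X i ω) ≤ c + R)
    (fun i h => by have := abs_le.1 (hR (X i ω)); linarith)
  have a2 := hmono (fun i => g (X i ω) ≤ c - R) (fun i => ghat (X i ω) ≤ c)
    (fun i h => by have := abs_le.1 (hR (X i ω)); linarith)
  have b1 := hF {x | ghat x ≤ c} {x | g x ≤ c + R}
    (fun x h => by have := abs_le.1 (hR x); simp only [Set.mem_ofPred_eq] at h ⊢; linarith)
  have b2 := hF {x | g x ≤ c - R} {x | ghat x ≤ c}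
    (fun x h => by have := abs_le.1 (hR x); simp only [Set.mem_ofPred_eq] at h ⊢; linarith)
  rw [← hG] at b1 b2
  rw [← hGhat] at a1 a2
  rw [abs_le]
  constructor <;> linarith
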